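/- Let L ≥ 3 and suppose p = q > 0. For every perfect matching σ of the hexagonal torus T_L and every column index ℓ ∈ ℤ/Lℤ, the generator applied to the charge X_ℓ satisfies the gradient condition: Σ_{σ'} 𝓛(σ,σ')·X_ℓ(σ') = 2·Y_ℓ(σ) − Y_{ℓ−1}(σ) − Y_{ℓ+1}(σ), where X_ℓ(σ) = Σ_{beads b of σ in column ℓ} (|I⁺_b(σ)| − |I⁻_b(σ)|) and Y_ℓ(σ) = (p/2)·Σ_{beads b of σ in column ℓ} ( |I⁻_b(σ)|·(|I⁻_b(σ)|+1) − |I⁺_b(σ)|·(|I⁺_b(σ)|+1) ). -/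

import Mathlib

/-!
Dimer coverings (perfect matchings) of the hexagonal torus `T_L`, beads, elementary
moves, and the sets `I⁺_b`, `I⁻_b` of positions available above/below a bead.

Statement-specific material follows the common setup below.

-/

namespace HexDimer

variable (L : ℕ)

/-- Positions `x ∈ (ℤ/Lℤ)²` indexing the white vertices `w_x`, the black vertices `b_x`,
and the horizontal edges (hence the faces / possible bead positions). -/
abbrev Pos := ZMod L × ZMod L

/-- An edge of the hexagonal torus is encoded by its white endpoint `x` together with a
direction `d : Fin 3`: `d = 0` is the horizontal edge `{w_x, b_x}`, `d = 1` is
`{w_x, b_{x+(1,0)}}`, `d = 2` is `{w_x, b_{x+(0,1)}}`. -/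
abbrev Edge := Pos L × Fin 3

/-- The displacement of the black endpoint of an edge in direction `d`. -/
def dvec : Fin 3 → Pos L := ![(0, 0), (1, 0), (0, 1)]

/-- A configuration: a (finite) set of edges. -/
abbrev Config := Finset (Edge L)

/-- `σ` is a perfect matching of the hexagonal torus: every white vertex `w_x` and every
black vertex `b_x` belongs to exactly one edge of `σ`. -/
def IsPM (σ : Config L) : Prop :=
  (∀ x : Pos L, ∃! d : Fin 3, (x, d) ∈ σ) ∧
  (∀ x : Pos L, ∃! e : Edge L, e ∈ σ ∧ e.1 + dvec L e.2 = x)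

/-- The upward shift `(1,-1)` along a column. -/
def u : Pos L := (1, -1)

/-- The set of beads (horizontal dimers) of `σ`, recorded by their positions. -/
def beadPos (σ : Config L) : Finset (Pos L) :=
  (σ.filter (fun e => e.2 = 0)).image Prod.fst

/-- The alternating triple of edges of the face `F_x` containing the lower horizontal
edge `{w_x, b_x}`: the edges `(x,0)`, `(x+(1,-1),2)` and `(x-(0,1),1)`. -/
def lowTriple (x : Pos L) : Finset (Edge L) :=
  {(x, 0), (x + u L, 2), (x - (0, 1), 1)}

/-- The alternating triple of edges of the face `F_x` containing the upper horizontal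
edge `{w_{x+(1,-1)}, b_{x+(1,-1)}}`: the edges `(x,1)`, `(x+(1,-1),0)` and `(x-(0,1),2)`. -/
def highTriple (x : Pos L) : Finset (Edge L) :=
  {(x, 1), (x + u L, 0), (x - (0, 1), 2)}

/-- The elementary up-move at the face `F_x` is allowed: `σ` contains the alternating
triple through the lower horizontal edge of `F_x` (in particular there is a bead at `x`). -/
def CanUp (σ : Config L) (x : Pos L) : Prop := lowTriple L x ⊆ σ

/-- The configuration after the elementary up-move at `F_x`: the three dimers of the low
triple are rotated onto the high triple; the bead at `x` moves up to `x + (1,-1)`. -/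
def upMove (σ : Config L) (x : Pos L) : Config L := (σ \ lowTriple L x) ∪ highTriple L x

/-- The elementary down-move bringing the bead at `x` down to `x - (1,-1)` is allowed. -/
def CanDown (σ : Config L) (x : Pos L) : Prop := highTriple L (x - u L) ⊆ σ

/-- The configuration after the elementary down-move of the bead at `x`. -/
def downMove (σ : Config L) (x : Pos L) : Config L :=
  (σ \ highTriple L (x - u L)) ∪ lowTriple L (x - u L)

/-- `UpPath σ x y σ'` holds if, starting from `σ` with a bead at `x`, a concatenation of
elementary up-moves (each moving this bead and no other bead) brings the bead to
position `y`, the configuration becoming `σ'`. -/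
inductive UpPath : Config L → Pos L → Pos L → Config L → Prop
  | refl (σ : Config L) (x : Pos L) : UpPath σ x x σ
  | step {σ : Config L} {x y : Pos L} {σ' : Config L} :
      CanUp L σ x → UpPath (upMove L σ x) (x + u L) y σ' → UpPath σ x y σ'

/-- `DownPath σ x y σ'`: a concatenation of elementary down-moves of a single bead brings
it from `x` to `y`, the configuration becoming `σ'`. -/
inductive DownPath : Config L → Pos L → Pos L → Config L → Prop
  | refl (σ : Config L) (x : Pos L) : DownPath σ x x σ
  | step {σ : Config L} {x y : Pos L} {σ' : Config L} :
      CanDown L σ x → DownPath (downMove L σ x) (x - u L) y σ' → DownPath σ x y σ'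

/-- `I⁺_b(σ)`: the set of positions available above the bead at `x`. -/
def Iplus (σ : Config L) (x : Pos L) : Set (Pos L) :=
  {y | y ≠ x ∧ ∃ σ' : Config L, UpPath L σ x y σ'}

/-- `I⁻_b(σ)`: the set of positions available below the bead at `x`. -/
def Iminus (σ : Config L) (x : Pos L) : Set (Pos L) :=
  {y | y ≠ x ∧ ∃ σ' : Config L, DownPath L σ x y σ'}


/-- The number of up-jumps from `σ` yielding `τ` (counted by the pair
(initial position, final position) of the jumping bead). -/
noncomputable def numUpJumps (σ τ : Config L) : ℕ :=
  Set.ncard {pr : Pos L × Pos L | pr.2 ≠ pr.1 ∧ UpPath L σ pr.1 pr.2 τ}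

/-- The number of down-jumps from `σ` yielding `τ`. -/
noncomputable def numDownJumps (σ τ : Config L) : ℕ :=
  Set.ncard {pr : Pos L × Pos L | pr.2 ≠ pr.1 ∧ DownPath L σ pr.1 pr.2 τ}

/-- The generator `𝓛` of the bead dynamics with rates `p` (up) and `q` (down). -/
noncomputable def Gen [NeZero L] (p q : ℝ) (σ τ : Config L) : ℝ :=
  if τ = σ then
    -∑ τ' ∈ Finset.univ.erase σ, (p * numUpJumps L σ τ' + q * numDownJumps L σ τ')
  else p * numUpJumps L σ τ + q * numDownJumps L σ τ

/-- The beads of `σ` lying in column `ℓ` (positions `x` with `x₁ + x₂ = ℓ`). -/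
def beadsInCol (σ : Config L) (ℓ : ZMod L) : Finset (Pos L) :=
  (beadPos L σ).filter (fun x => x.1 + x.2 = ℓ)

/-- The charge of column `ℓ`: `X_ℓ(σ) = ∑_{beads b in column ℓ} (|I⁺_b(σ)| − |I⁻_b(σ)|)`. -/
noncomputable def Xcharge (σ : Config L) (ℓ : ZMod L) : ℝ :=
  ∑ b ∈ beadsInCol L σ ℓ, (((Iplus L σ b).ncard : ℝ) - ((Iminus L σ b).ncard : ℝ))

/-- The current
`Y_ℓ(σ) = (p/2)·∑_{beads b in column ℓ} (|I⁻_b|(|I⁻_b|+1) − |I⁺_b|(|I⁺_b|+1))`. -/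
noncomputable def Ycur (p : ℝ) (σ : Config L) (ℓ : ZMod L) : ℝ :=
  (p / 2) * ∑ b ∈ beadsInCol L σ ℓ,
    (((Iminus L σ b).ncard : ℝ) * (((Iminus L σ b).ncard : ℝ) + 1) -
      ((Iplus L σ b).ncard : ℝ) * (((Iplus L σ b).ncard : ℝ) + 1))

/-- Exactly one of three propositions holds. -/
def ExactlyOne (a b c : Prop) : Prop :=
  (a ∧ ¬b ∧ ¬c) ∨ (¬a ∧ b ∧ ¬c) ∨ (¬a ∧ ¬b ∧ c)

theorem existsUnique_fin_three (r : Fin 3 → Prop) :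
    (∃! d, r d) ↔ ExactlyOne (r 0) (r 1) (r 2) := by
  simp only [ExistsUnique, ExactlyOne, Fin.exists_fin_succ, Fin.forall_fin_succ]
  simp
  tauto

variable {L}

theorem isPM_iff (σ : Config L) : IsPM L σ ↔
    ∀ x : Pos L, ExactlyOne ((x, 0) ∈ σ) ((x, 1) ∈ σ) ((x, 2) ∈ σ) ∧
      ExactlyOne ((x, 0) ∈ σ) ((x - (1, 0), 1) ∈ σ) ((x - (0, 1), 2) ∈ σ) := by
  have black : ∀ x : Pos L, (∃! e : Edge L, e ∈ σ ∧ e.1 + dvec L e.2 = x) ↔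
      ∃! d : Fin 3, (x - dvec L d, d) ∈ σ := by
    intro x
    constructor
    · rintro ⟨⟨y, d⟩, ⟨h, rfl⟩, hu⟩
      refine ⟨d, by simpa using h, fun d' hd' => ?_⟩
      have := hu (_, d') ⟨hd', by simp⟩
      exact congrArg Prod.snd this
    · rintro ⟨d, h, hu⟩
      refine ⟨(x - dvec L d, d), ⟨h, by simp⟩, ?_⟩
      rintro ⟨y, d'⟩ ⟨h', rfl⟩
      obtain rfl := hu d' (by simpa using h')
      simp
  simp only [IsPM, black, existsUnique_fin_three]
  simp [dvec, forall_and, Prod.mk_zero_zero]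

theorem canUp_iff (σ : Config L) (x : Pos L) :
    CanUp L σ x ↔ (x, 0) ∈ σ ∧ (x + u L, 2) ∈ σ ∧ (x - (0, 1), 1) ∈ σ := by
  simp [CanUp, lowTriple, Finset.insert_subset_iff]

theorem mem_upMove_zero (σ : Config L) (x y : Pos L) :
    (y, 0) ∈ upMove L σ x ↔ ((y, 0) ∈ σ ∧ y ≠ x) ∨ y = x + u L := by
  simp [upMove, lowTriple, highTriple]
  tauto

theorem mem_upMove_one (σ : Config L) (x y : Pos L) :
    (y, 1) ∈ upMove L σ x ↔ ((y, 1) ∈ σ ∧ y ≠ x - (0, 1)) ∨ y = x := by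
  simp [upMove, lowTriple, highTriple]
  tauto

theorem mem_upMove_two (σ : Config L) (x y : Pos L) :
    (y, 2) ∈ upMove L σ x ↔ ((y, 2) ∈ σ ∧ y ≠ x + u L) ∨ y = x - (0, 1) := by
  simp [upMove, lowTriple, highTriple]
  tauto

theorem isPM_upMove [Nontrivial (ZMod L)] {σ : Config L} (hσ : IsPM L σ) {x : Pos L}
    (hx : CanUp L σ x) : IsPM L (upMove L σ x) := by
  rw [isPM_iff] at hσ ⊢
  rw [canUp_iff] at hx
  have one : (1 : ZMod L) ≠ 0 := one_ne_zero
  have e₁ : x + u L - (0, 1) ≠ x := by simp [u, Prod.ext_iff, sub_eq_add_neg]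
  have d₁ : x + u L ≠ x := by simp [u, Prod.ext_iff]
  have d₂ : x - (0, 1) ≠ x := by simp [Prod.ext_iff]
  have d₃ : x + u L ≠ x - (0, 1) := by simp [u, Prod.ext_iff, sub_eq_add_neg]
  intro y
  obtain ⟨hw, hb⟩ := hσ y
  simp only [mem_upMove_zero, mem_upMove_one, mem_upMove_two]
  refine ⟨?_, ?_⟩
  · have := (hσ x).1
    have := (hσ (x + u L)).1
    have := (hσ (x - (0, 1))).1
    unfold ExactlyOne at *
    grind
  · have s₁ : y - (1, 0) = x - (0, 1) ↔ y = x + u L := by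
      simp [u, Prod.ext_iff]; grind
    have s₂ : y - (0, 1) = x + u L ↔ y = x + (1, 0) := by
      simp [u, Prod.ext_iff]; grind
    have s₃ : y - (1, 0) = x ↔ y = x + (1, 0) := sub_eq_iff_eq_add
    have s₄ : y - (0, 1) = x - (0, 1) ↔ y = x := by simp
    simp only [ne_eq, s₁, s₂, s₃, s₄]
    have t₁ : x + u L - (1, 0) = x - (0, 1) := by simp [u, Prod.ext_iff]; grind
    have t₂ : x + (1, 0) - (0, 1) = x + u L := by simp [u, Prod.ext_iff]; grind
    have t₃ : x + (1, 0) ≠ x := by simp [Prod.ext_iff]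
    have t₄ : x + (1, 0) ≠ x + u L := by simp [u, Prod.ext_iff]
    have b₁ := (hσ x).2
    have b₂ := (hσ (x + u L)).2
    have b₃ := (hσ (x + (1, 0))).2
    rw [t₁] at b₂
    rw [t₂] at b₃
    unfold ExactlyOne at *
    grind

/-- The site `y` is not a bead and can be crossed upwards: its white vertex has direction `2`
and its black vertex is matched in direction `1`. -/
def UpFree (σ : Config L) (y : Pos L) : Prop := (y, 2) ∈ σ ∧ (y - (1, 0), 1) ∈ σ

theorem canUp_iff_upFree (σ : Config L) (x : Pos L) :
    CanUp L σ x ↔ (x, 0) ∈ σ ∧ UpFree σ (x + u L) := by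
  have t : x + u L - (1, 0) = x - (0, 1) := by simp [u, Prod.ext_iff]; grind
  rw [canUp_iff, UpFree, t]

theorem UpFree.not_bead {σ : Config L} (hσ : IsPM L σ) {y : Pos L} (h : UpFree σ y) :
    (y, 0) ∉ σ := by
  have := ((isPM_iff σ).1 hσ y).1
  unfold ExactlyOne UpFree at *
  tauto

theorem UpFree.sub_u {σ : Config L} (hσ : IsPM L σ) {y : Pos L} (h : UpFree σ y)
    (hb : (y - u L, 0) ∉ σ) : UpFree σ (y - u L) := by
  rw [isPM_iff] at hσ
  have t₁ : y - u L - (0, 1) = y - (1, 0) := by simp [u, Prod.ext_iff]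
  have t₂ : y + (0, 1) - (1, 0) = y - u L := by simp [u, Prod.ext_iff]
  have h₁ := hσ (y - u L)
  have h₂ := (hσ (y - (1, 0))).1
  have h₃ := (hσ (y + (0, 1))).2
  rw [t₁] at h₁
  rw [t₂, add_sub_cancel_right] at h₃
  unfold ExactlyOne UpFree at *
  tauto

/-- The configuration obtained by moving the bead at `x` upwards `k` times. -/
def upIter : ℕ → Config L → Pos L → Config L
  | 0, σ, _ => σ
  | k + 1, σ, x => upIter k (upMove L σ x) (x + u L)

/-- The bead at `x` can move upwards `k` times in a row. -/
def UpReach : ℕ → Config L → Pos L → Prop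
  | 0, _, _ => True
  | k + 1, σ, x => CanUp L σ x ∧ UpReach k (upMove L σ x) (x + u L)

theorem upPath_iff (σ : Config L) (x y : Pos L) (τ : Config L) :
    UpPath L σ x y τ ↔ ∃ k : ℕ, y = x + k • u L ∧ τ = upIter k σ x ∧ UpReach k σ x := by
  constructor
  · intro h
    induction h with
    | refl σ x => exact ⟨0, by simp, rfl, trivial⟩
    | step hc _ ih =>
      obtain ⟨k, h₁, h₂, h₃⟩ := ih
      exact ⟨k + 1, by rw [h₁, succ_nsmul']; abel, h₂, hc, h₃⟩
  · rintro ⟨k, rfl, rfl, hr⟩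
    induction k generalizing σ x with
    | zero => simpa using! UpPath.refl σ x
    | succ k ih =>
      have := UpPath.step hr.1 (ih _ _ hr.2)
      rwa [add_assoc, ← succ_nsmul'] at this

theorem nsmul_u (k : ℕ) : k • u L = ((k : ZMod L), -(k : ZMod L)) := by
  simp [u]

theorem col_add_nsmul_u (x : Pos L) (k : ℕ) :
    (x + k • u L).1 + (x + k • u L).2 = x.1 + x.2 := by
  rw [nsmul_u]
  simp only [Prod.fst_add, Prod.snd_add]
  ring

theorem add_nsmul_u_inj {x : Pos L} {j k : ℕ} (hj : j < L) (hk : k < L)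
    (h : x + j • u L = x + k • u L) : j = k := by
  have h := congrArg Prod.fst (add_left_cancel h)
  rw [nsmul_u, nsmul_u] at h
  have := (ZMod.natCast_eq_natCast_iff' _ _ _).1 h
  rwa [Nat.mod_eq_of_lt hj, Nat.mod_eq_of_lt hk] at this

theorem upFree_upMove [Nontrivial (ZMod L)] {σ : Config L} {x y : Pos L}
    (hy : y.1 + y.2 = x.1 + x.2) :
    UpFree (upMove L σ x) y ↔ UpFree σ y ∧ y ≠ x + u L := by
  have one : (1 : ZMod L) ≠ 0 := one_ne_zero
  have h₁ : y ≠ x - (0, 1) := by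
    rintro rfl
    exact one (by simp only [Prod.fst_sub, Prod.snd_sub] at hy; linear_combination -hy)
  have h₂ : y - (1, 0) ≠ x := by
    rintro rfl
    exact one (by simp only [Prod.fst_sub, Prod.snd_sub] at hy; linear_combination hy)
  have h₃ : y - (1, 0) = x - (0, 1) ↔ y = x + u L := by
    simp [u, Prod.ext_iff]; grind
  unfold UpFree
  rw [mem_upMove_one, mem_upMove_two]
  simp only [h₁, h₂, ne_eq, h₃]
  tauto

theorem upReach_iff [Nontrivial (ZMod L)] [NeZero L] (k : ℕ) {σ : Config L} (hσ : IsPM L σ)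
    (x : Pos L) :
    UpReach k σ x ↔
      (k = 0 ∨ (x, 0) ∈ σ) ∧ ∀ j, 1 ≤ j → j ≤ k → UpFree σ (x + j • u L) := by
  induction k generalizing σ x with
  | zero => simp [UpReach]; omega
  | succ k ih =>
    have shift : ∀ j : ℕ, x + u L + j • u L = x + (j + 1) • u L := by
      intro j; rw [succ_nsmul']; abel
    have free : ∀ j : ℕ, UpFree (upMove L σ x) (x + u L + j • u L) ↔
        UpFree σ (x + (j + 1) • u L) ∧ x + (j + 1) • u L ≠ x + u L := by
      intro j
      rw [shift, upFree_upMove (col_add_nsmul_u _ _)]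
    have bead : (x + u L, 0) ∈ upMove L σ x := by simp [mem_upMove_zero]
    simp only [UpReach]
    constructor
    · rintro ⟨hc, hr⟩
      rw [ih (isPM_upMove hσ hc)] at hr
      rw [canUp_iff_upFree] at hc
      refine ⟨.inr hc.1, fun j h₁ h₂ => ?_⟩
      obtain rfl | ⟨j, rfl⟩ : j = 1 ∨ ∃ i, j = i + 2 :=
        (show j = 1 ∨ 2 ≤ j by omega).imp_right fun h => ⟨j - 2, by omega⟩
      · simpa using hc.2
      · exact ((free (j + 1)).1 (hr.2 (j + 1) (by omega) (by omega))).1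
    · rintro ⟨hb, hr⟩
      have hb : (x, 0) ∈ σ := by simpa using hb
      have hc : CanUp L σ x := by
        rw [canUp_iff_upFree]
        exact ⟨hb, by simpa using hr 1 le_rfl (by omega)⟩
      refine ⟨hc, (ih (isPM_upMove hσ hc) _).2 ⟨.inr bead, fun j h₁ h₂ => ?_⟩⟩
      refine (free j).2 ⟨hr _ (by omega) (by omega), fun h => ?_⟩
      have hL : (L : ℕ) ≤ k := by
        rw [succ_nsmul', ← add_assoc, add_eq_left, nsmul_u] at h
        have h := (ZMod.natCast_eq_zero_iff j L).1 (congrArg Prod.fst h)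
        exact (Nat.le_of_dvd (by omega) h).trans h₂
      have := hr L (Nat.one_le_iff_ne_zero.2 (NeZero.ne L)) (by omega)
      have e : x + L • u L = x := by rw [nsmul_u]; simp
      rw [e] at this
      exact this.not_bead hσ hb

theorem UpReach.lt [Nontrivial (ZMod L)] [NeZero L] {k : ℕ} {σ : Config L} (hσ : IsPM L σ)
    {x : Pos L} (h : UpReach k σ x) : k < L := by
  have h0 := NeZero.ne L
  by_contra! hk
  rw [upReach_iff k hσ] at h
  have := h.2 L (by omega) hk
  have e : x + L • u L = x := by rw [nsmul_u]; simp
  rw [e] at this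
  exact this.not_bead hσ (h.1.resolve_left (by omega))

open Classical in
/-- The greatest number of consecutive up-moves of the bead at `x`. -/
noncomputable def upNum (σ : Config L) (x : Pos L) : ℕ :=
  Nat.findGreatest (fun k => UpReach k σ x) L

theorem upReach_iff_le [Nontrivial (ZMod L)] [NeZero L] {k : ℕ} {σ : Config L}
    (hσ : IsPM L σ) (x : Pos L) : UpReach k σ x ↔ k ≤ upNum σ x := by
  classical
  have hspec : UpReach (upNum σ x) σ x := by
    unfold upNum
    exact Nat.findGreatest_spec (P := fun k => UpReach k σ x) (Nat.zero_le L) trivial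
  constructor
  · intro h
    exact Nat.le_findGreatest (h.lt hσ).le h
  · intro h
    rw [upReach_iff _ hσ] at hspec ⊢
    exact ⟨by exact hspec.1.imp_left (by omega), fun j h₁ h₂ => hspec.2 j h₁ (by omega)⟩

theorem upNum_lt [Nontrivial (ZMod L)] [NeZero L] {σ : Config L} (hσ : IsPM L σ)
    (x : Pos L) : upNum σ x < L :=
  ((upReach_iff_le hσ x).2 le_rfl).lt hσ

theorem upPath_ne_iff [Nontrivial (ZMod L)] [NeZero L] {σ : Config L} (hσ : IsPM L σ)
    (x y : Pos L) (τ : Config L) :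
    y ≠ x ∧ UpPath L σ x y τ ↔
      ∃ k ∈ Finset.Icc 1 (upNum σ x), y = x + k • u L ∧ τ = upIter k σ x := by
  rw [upPath_iff]
  constructor
  · rintro ⟨hne, k, rfl, rfl, hr⟩
    refine ⟨k, ?_, rfl, rfl⟩
    rw [Finset.mem_Icc, ← upReach_iff_le hσ]
    exact ⟨Nat.one_le_iff_ne_zero.2 fun h => hne (by simp [h]), hr⟩
  · rintro ⟨k, hk, rfl, rfl⟩
    rw [Finset.mem_Icc] at hk
    have := upNum_lt hσ x
    refine ⟨fun h => ?_, k, rfl, rfl, (upReach_iff_le hσ x).2 hk.2⟩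
    have := add_nsmul_u_inj (x := x) (j := k) (k := 0) (by omega) (by omega) (by simpa using h)
    omega

theorem injOn_add_nsmul_u [Nontrivial (ZMod L)] [NeZero L] {σ : Config L} (hσ : IsPM L σ)
    (x : Pos L) :
    Set.InjOn (fun k : ℕ => x + k • u L) (Finset.Icc 1 (upNum σ x) : Set ℕ) := by
  intro j hj k hk h
  have := upNum_lt hσ x
  simp only [Finset.coe_Icc, Set.mem_Icc] at hj hk
  exact add_nsmul_u_inj (by omega) (by omega) h

theorem Iplus_eq [Nontrivial (ZMod L)] [NeZero L] {σ : Config L} (hσ : IsPM L σ)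
    (x : Pos L) :
    Iplus L σ x = ((Finset.Icc 1 (upNum σ x)).image fun k : ℕ => x + k • u L : Finset (Pos L)) := by
  ext y
  simp only [Iplus, Set.mem_ofPred_eq, ← exists_and_left, upPath_ne_iff hσ]
  simp only [Finset.coe_image, Set.mem_image, SetLike.mem_coe]
  constructor
  · rintro ⟨τ, k, hk, rfl, rfl⟩; exact ⟨k, hk, rfl⟩
  · rintro ⟨k, hk, rfl⟩; exact ⟨_, k, hk, rfl, rfl⟩

theorem ncard_Iplus [Nontrivial (ZMod L)] [NeZero L] {σ : Config L} (hσ : IsPM L σ)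
    (x : Pos L) : (Iplus L σ x).ncard = upNum σ x := by
  rw [Iplus_eq hσ, Set.ncard_coe_finset, Finset.card_image_of_injOn (injOn_add_nsmul_u hσ x)]
  simp

theorem mem_beadsInCol (σ : Config L) (ℓ : ZMod L) (x : Pos L) :
    x ∈ beadsInCol L σ ℓ ↔ (x, 0) ∈ σ ∧ x.1 + x.2 = ℓ := by
  simp only [beadsInCol, beadPos, Finset.mem_filter, Finset.mem_image]
  refine and_congr_left fun _ => ⟨?_, fun h => ⟨_, ⟨h, rfl⟩, rfl⟩⟩
  rintro ⟨⟨y, d⟩, ⟨h, rfl⟩, rfl⟩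
  exact h

theorem upNum_eq_zero [Nontrivial (ZMod L)] [NeZero L] {σ : Config L} (hσ : IsPM L σ)
    {x : Pos L} (hx : (x, 0) ∉ σ) : upNum σ x = 0 := by
  have := (upReach_iff _ hσ x).1 ((upReach_iff_le hσ x).2 le_rfl)
  tauto

theorem UpFree.exists_bead {σ : Config L} (hσ : IsPM L σ) (m : ℕ) {y : Pos L}
    (hy : UpFree σ y) (hm : (y - m • u L, 0) ∈ σ) :
    ∃ (x : Pos L) (k : ℕ), (x, 0) ∈ σ ∧ 1 ≤ k ∧ y = x + k • u L ∧
      ∀ j, 1 ≤ j → j ≤ k → UpFree σ (x + j • u L) := by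
  induction m generalizing y with
  | zero => exact absurd (by simpa using hm) (hy.not_bead hσ)
  | succ m ih =>
    by_cases hb : (y - u L, 0) ∈ σ
    · refine ⟨y - u L, 1, hb, le_rfl, by simp, fun j h₁ h₂ => ?_⟩
      obtain rfl : j = 1 := by omega
      simpa using hy
    · obtain ⟨x, k, h₁, h₂, h₃, h₄⟩ := ih (hy.sub_u hσ hb) (by
        rwa [succ_nsmul', ← sub_sub] at hm)
      have hyx : y = x + (k + 1) • u L := by
        rw [succ_nsmul, ← add_assoc, ← h₃]; simp
      refine ⟨x, k + 1, h₁, by omega, hyx, fun j h₅ h₆ => ?_⟩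
      obtain h | rfl : j ≤ k ∨ j = k + 1 := by omega
      · exact h₄ j h₅ h
      · rwa [← hyx]

open Classical in
theorem sum_upNum [Nontrivial (ZMod L)] [NeZero L] {σ : Config L} (hσ : IsPM L σ)
    (ℓ : ZMod L) (hℓ : (beadsInCol L σ ℓ).Nonempty) :
    ∑ x ∈ beadsInCol L σ ℓ, upNum σ x =
      (Finset.univ.filter fun y : Pos L => y.1 + y.2 = ℓ ∧ UpFree σ y).card := by
  have hcover : (Finset.univ.filter fun y : Pos L => y.1 + y.2 = ℓ ∧ UpFree σ y) =
      (beadsInCol L σ ℓ).biUnion fun x =>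
        (Finset.Icc 1 (upNum σ x)).image fun k : ℕ => x + k • u L := by
    ext y
    simp only [Finset.mem_filter, Finset.mem_univ, true_and, Finset.mem_biUnion,
      Finset.mem_image, Finset.mem_Icc, mem_beadsInCol]
    constructor
    · rintro ⟨hy, hf⟩
      obtain ⟨c, hc⟩ := hℓ
      rw [mem_beadsInCol] at hc
      have hyc : y - (y.1 - c.1).val • u L = c := by
        rw [nsmul_u]
        simp only [ZMod.natCast_val, ZMod.cast_id', id_eq]
        ext <;> simp
        grind
      obtain ⟨x, k, h₁, h₂, rfl, h₄⟩ := hf.exists_bead hσ (y.1 - c.1).val (by rw [hyc]; exact hc.1)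
      refine ⟨x, ⟨h₁, ?_⟩, k, ⟨h₂, ?_⟩, rfl⟩
      · rw [← hy, col_add_nsmul_u]
      · rw [← upReach_iff_le hσ, upReach_iff _ hσ]
        exact ⟨.inr h₁, h₄⟩
    · rintro ⟨x, ⟨h₁, h₂⟩, k, ⟨h₃, h₄⟩, rfl⟩
      rw [← upReach_iff_le hσ, upReach_iff _ hσ] at h₄
      exact ⟨by rw [← h₂, col_add_nsmul_u], h₄.2 k h₃ le_rfl⟩
  have hle : ∀ x x' : Pos L, (x, 0) ∈ σ → ∀ k k' : ℕ, k ≤ k' → 1 ≤ k → k' ≤ upNum σ x' →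
      x + k • u L = x' + k' • u L → x = x' := by
    intro x x' hx k k' hkk hk hk' h
    obtain ⟨i, rfl⟩ := Nat.exists_eq_add_of_le' hkk
    rw [add_nsmul, ← add_assoc] at h
    have h := add_right_cancel h
    rcases Nat.eq_zero_or_pos i with rfl | hi
    · simpa using h
    · rw [← upReach_iff_le hσ, upReach_iff _ hσ] at hk'
      have := hk'.2 i hi (by omega)
      rw [← h] at this
      exact absurd hx (this.not_bead hσ)
  rw [hcover, Finset.card_biUnion]
  · refine Finset.sum_congr rfl fun x _ => ?_
    rw [Finset.card_image_of_injOn (injOn_add_nsmul_u hσ x)]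
    simp
  · intro x hx x' hx' hne
    rw [SetLike.mem_coe, mem_beadsInCol] at hx hx'
    rw [Function.onFun, Finset.disjoint_left]
    intro y hy hy'
    simp only [Finset.mem_image, Finset.mem_Icc] at hy hy'
    obtain ⟨k, hk, rfl⟩ := hy
    obtain ⟨k', hk', h⟩ := hy'
    rcases le_total k k' with hkk | hkk
    · exact hne (hle x x' hx.1 k k' hkk hk.1 hk'.2 h.symm)
    · exact hne (hle x' x hx'.1 k' k hkk hk'.1 hk.2 h).symm

open Classical in
/-- The number of edges of direction `d` whose white vertex lies in column `ℓ`. -/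
noncomputable def edgeCount [NeZero L] (d : Fin 3) (σ : Config L) (ℓ : ZMod L) : ℝ :=
  ∑ y : Pos L, if y.1 + y.2 = ℓ ∧ (y, d) ∈ σ then 1 else 0

open Classical in
theorem sum_shift [NeZero L] (d : Fin 3) (σ : Config L) (ℓ : ZMod L) (v : Pos L)
    (hv : v.1 + v.2 = 1) :
    (∑ y : Pos L, if y.1 + y.2 = ℓ ∧ (y - v, d) ∈ σ then (1 : ℝ) else 0) =
      edgeCount d σ (ℓ - 1) := by
  rw [edgeCount, ← Equiv.sum_comp (Equiv.subRight v)
    (fun y => if y.1 + y.2 = ℓ - 1 ∧ (y, d) ∈ σ then (1 : ℝ) else 0)]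
  refine Finset.sum_congr rfl fun y _ => ?_
  have : y.1 + y.2 = ℓ ↔ (y - v).1 + (y - v).2 = ℓ - 1 := by
    simp only [Prod.fst_sub, Prod.snd_sub]
    constructor <;> intro h
    · linear_combination h - hv
    · linear_combination h + hv
  simp only [Equiv.subRight_apply, this]

open Classical in
theorem edgeCount_zero_sub_one [NeZero L] {σ : Config L} (hσ : IsPM L σ) (ℓ : ZMod L) :
    edgeCount 0 σ (ℓ - 1) = edgeCount 0 σ ℓ := by
  rw [isPM_iff] at hσ
  have white : ∀ ℓ : ZMod L, (∑ y : Pos L, if y.1 + y.2 = ℓ then (1 : ℝ) else 0) =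
      edgeCount 0 σ ℓ + edgeCount 1 σ ℓ + edgeCount 2 σ ℓ := by
    intro ℓ
    simp only [edgeCount, ← Finset.sum_add_distrib]
    refine Finset.sum_congr rfl fun y _ => ?_
    obtain ⟨h, h', h''⟩ | ⟨h, h', h''⟩ | ⟨h, h', h''⟩ := (hσ y).1 <;> simp [h, h', h'']
  have black : (∑ y : Pos L, if y.1 + y.2 = ℓ then (1 : ℝ) else 0) =
      edgeCount 0 σ ℓ + edgeCount 1 σ (ℓ - 1) + edgeCount 2 σ (ℓ - 1) := by
    rw [← sum_shift 1 σ ℓ (1, 0) (by simp), ← sum_shift 2 σ ℓ (0, 1) (by simp), edgeCount]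
    simp only [← Finset.sum_add_distrib]
    refine Finset.sum_congr rfl fun y _ => ?_
    obtain ⟨h, h', h''⟩ | ⟨h, h', h''⟩ | ⟨h, h', h''⟩ := (hσ y).2 <;> simp [h, h', h'']
  have shift : (∑ y : Pos L, if y.1 + y.2 = ℓ then (1 : ℝ) else 0) =
      ∑ y : Pos L, if y.1 + y.2 = ℓ - 1 then (1 : ℝ) else 0 := by
    simpa [edgeCount] using sum_shift 0 (Finset.univ : Config L) ℓ (1, 0) (by simp)
  linarith [white (ℓ - 1)]

open Classical in
theorem edgeCount_zero [NeZero L] (σ : Config L) (ℓ : ZMod L) :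
    edgeCount 0 σ ℓ = (beadsInCol L σ ℓ).card := by
  rw [edgeCount, Finset.sum_boole]
  congr 2
  ext x
  simp [mem_beadsInCol, and_comm]

theorem edgeCount_zero_eq [NeZero L] {σ : Config L} (hσ : IsPM L σ) (ℓ m : ZMod L) :
    edgeCount 0 σ ℓ = edgeCount 0 σ m := by
  have h : ∀ n : ℕ, edgeCount 0 σ (ℓ - n) = edgeCount 0 σ ℓ := by
    intro n
    induction n with
    | zero => simp
    | succ n ih =>
      rw [Nat.cast_succ, ← sub_sub, edgeCount_zero_sub_one hσ, ih]
  rw [← h (ℓ - m).val]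
  simp

theorem beadsInCol_nonempty [NeZero L] {σ : Config L} (hσ : IsPM L σ) {x : Pos L}
    (hx : (x, 0) ∈ σ) (ℓ : ZMod L) : (beadsInCol L σ ℓ).Nonempty := by
  have h := edgeCount_zero_eq hσ ℓ (x.1 + x.2)
  rw [edgeCount_zero, edgeCount_zero, Nat.cast_inj] at h
  rw [← Finset.card_pos, h, Finset.card_pos]
  exact ⟨x, (mem_beadsInCol _ _ _).2 ⟨hx, rfl⟩⟩

/-- The reflection of the torus exchanging the two coordinates, acting on edges. -/
def reflEdge : Edge L ≃ Edge L :=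
  (Equiv.prodComm _ _).prodCongr (Equiv.swap 1 2)

theorem reflEdge_zero (x : Pos L) : reflEdge (x, 0) = (x.swap, 0) := rfl

theorem reflEdge_one (x : Pos L) : reflEdge (x, 1) = (x.swap, 2) := rfl

theorem reflEdge_two (x : Pos L) : reflEdge (x, 2) = (x.swap, 1) := rfl

theorem reflEdge_reflEdge (e : Edge L) : reflEdge (reflEdge e) = e := by
  obtain ⟨x, d⟩ := e
  simp [reflEdge]

/-- The reflection of a configuration. -/
def refl (σ : Config L) : Config L := σ.map reflEdge.toEmbedding

theorem mem_refl (σ : Config L) (e : Edge L) : e ∈ refl σ ↔ reflEdge e ∈ σ := by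
  simp only [refl, Finset.mem_map_equiv]
  rw [show reflEdge.symm e = reflEdge e by rw [Equiv.symm_apply_eq, reflEdge_reflEdge]]

theorem refl_refl (σ : Config L) : refl (refl σ) = σ := by
  ext e
  rw [mem_refl, mem_refl, reflEdge_reflEdge]

/-- The reflection as a permutation of the configurations. -/
def reflEquiv : Config L ≃ Config L := ⟨refl, refl, refl_refl, refl_refl⟩

theorem mem_refl_zero (σ : Config L) (x : Pos L) : (x, 0) ∈ refl σ ↔ (x.swap, 0) ∈ σ := by
  rw [mem_refl, reflEdge_zero]

theorem mem_refl_one (σ : Config L) (x : Pos L) : (x, 1) ∈ refl σ ↔ (x.swap, 2) ∈ σ := by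
  rw [mem_refl, reflEdge_one]

theorem mem_refl_two (σ : Config L) (x : Pos L) : (x, 2) ∈ refl σ ↔ (x.swap, 1) ∈ σ := by
  rw [mem_refl, reflEdge_two]

theorem isPM_refl {σ : Config L} (hσ : IsPM L σ) : IsPM L (refl σ) := by
  rw [isPM_iff] at hσ ⊢
  intro x
  have h := hσ x.swap
  simp only [mem_refl_zero, mem_refl_one, mem_refl_two, Prod.swap_sub, Prod.swap_prod_mk]
  unfold ExactlyOne at *
  tauto

theorem swap_sub_u (x : Pos L) : (x - u L).swap = x.swap + u L := by
  simp [u, sub_eq_add_neg]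

theorem map_highTriple (x : Pos L) :
    (highTriple L (x - u L)).map reflEdge.toEmbedding = lowTriple L x.swap := by
  have h₁ : (x - u L).swap = x.swap + u L := swap_sub_u x
  have h₂ : (x - u L - (0, 1)).swap = x.swap - (0, 1) := by simp [u, Prod.ext_iff]
  simp [highTriple, lowTriple, reflEdge_zero, reflEdge_one, reflEdge_two, h₁, h₂]
  grind

theorem map_lowTriple (x : Pos L) :
    (lowTriple L (x - u L)).map reflEdge.toEmbedding = highTriple L x.swap := by
  have h₁ : (x - u L).swap = x.swap + u L := swap_sub_u x
  have h₂ : (x - u L - (0, 1)).swap = x.swap - (0, 1) := by simp [u, Prod.ext_iff]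
  simp [highTriple, lowTriple, reflEdge_zero, reflEdge_one, reflEdge_two, h₁, h₂]
  grind

theorem canUp_refl (σ : Config L) (x : Pos L) : CanUp L (refl σ) x.swap ↔ CanDown L σ x := by
  rw [CanUp, CanDown, refl, ← map_highTriple, Finset.map_subset_map]

theorem upMove_refl (σ : Config L) (x : Pos L) :
    upMove L (refl σ) x.swap = refl (downMove L σ x) := by
  rw [upMove, downMove, refl, refl, ← map_highTriple, ← map_lowTriple, Finset.map_union,
    Finset.map_sdiff]

theorem upPath_refl (σ τ : Config L) (x y : Pos L) :
    UpPath L (refl σ) x.swap y.swap (refl τ) ↔ DownPath L σ x y τ := by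
  constructor
  · intro h
    generalize hσ : refl σ = σ' at h
    generalize hτ : refl τ = τ' at h
    generalize hx : x.swap = x' at h
    generalize hy : y.swap = y' at h
    induction h generalizing σ x with
    | refl σ' x' =>
      obtain rfl : σ = τ := by rw [← refl_refl σ, hσ, ← hτ, refl_refl]
      obtain rfl : x = y := Prod.swap_injective (hx.trans hy.symm)
      exact .refl _ _
    | step hc _ ih =>
      subst hσ hx
      exact .step ((canUp_refl _ _).1 hc) (ih _ _ (upMove_refl _ _).symm hτ (swap_sub_u x) hy)
  · intro h
    induction h with
    | refl σ x => exact .refl _ _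
    | step hc _ ih =>
      rw [← upMove_refl, swap_sub_u] at ih
      exact .step ((canUp_refl _ _).2 hc) ih

theorem ncard_Iminus [Nontrivial (ZMod L)] [NeZero L] {σ : Config L} (hσ : IsPM L σ)
    (x : Pos L) : (Iminus L σ x).ncard = upNum (refl σ) x.swap := by
  rw [← ncard_Iplus (isPM_refl hσ), ← Set.ncard_image_of_injective _ Prod.swap_injective]
  congr 1
  ext y
  obtain ⟨y, rfl⟩ := Prod.swap_surjective y
  simp only [Iminus, Iplus, Set.mem_image, Set.mem_ofPred_eq, Prod.swap_inj]
  constructor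
  · rintro ⟨y', ⟨hne, τ, h⟩, rfl⟩
    exact ⟨Prod.swap_injective.ne hne, _, (upPath_refl _ _ _ _).2 h⟩
  · rintro ⟨hne, τ, h⟩
    exact ⟨y, ⟨fun h => hne (congrArg _ h), refl τ, (upPath_refl _ _ _ _).1 (by rwa [refl_refl])⟩, rfl⟩

theorem numDownJumps_eq (σ τ : Config L) :
    numDownJumps L σ τ = numUpJumps L (refl σ) (refl τ) := by
  have hinj : Function.Injective (Prod.map Prod.swap Prod.swap : Pos L × Pos L → Pos L × Pos L) :=
    Prod.swap_injective.prodMap Prod.swap_injective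
  rw [numDownJumps, numUpJumps, ← Set.ncard_image_of_injective _ hinj]
  congr 1
  ext ⟨x, y⟩
  obtain ⟨x, rfl⟩ := Prod.swap_surjective x
  obtain ⟨y, rfl⟩ := Prod.swap_surjective y
  simp only [Set.mem_image, Set.mem_ofPred_eq, upPath_refl, Prod.swap_inj, ne_eq]
  constructor
  · rintro ⟨⟨x', y'⟩, h, he⟩
    simp only [Prod.map_apply, Prod.mk.injEq, Prod.swap_inj] at he
    obtain ⟨rfl, rfl⟩ := he
    exact h
  · exact fun h => ⟨(x, y), h, rfl⟩

theorem sum_beadsInCol_refl {M : Type*} [AddCommMonoid M] (σ : Config L) (ℓ : ZMod L)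
    (f : Pos L → M) :
    ∑ x ∈ beadsInCol L (refl σ) ℓ, f x = ∑ x ∈ beadsInCol L σ ℓ, f x.swap := by
  refine Finset.sum_equiv (Equiv.prodComm _ _) (fun x => ?_) (fun x _ => by simp)
  simp [mem_beadsInCol, mem_refl_zero, add_comm]

theorem upFree_refl (σ : Config L) (y : Pos L) :
    UpFree (refl σ) y.swap ↔ (y, 1) ∈ σ ∧ (y - (0, 1), 2) ∈ σ := by
  simp [UpFree, mem_refl_one, mem_refl_two]

/-- The charge of a non-empty column is a difference of local edge counts. -/
theorem Xcharge_eq [Nontrivial (ZMod L)] [NeZero L] {σ : Config L} (hσ : IsPM L σ)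
    {x : Pos L} (hx : (x, 0) ∈ σ) (ℓ : ZMod L) :
    Xcharge L σ ℓ = edgeCount 1 σ (ℓ - 1) - edgeCount 1 σ ℓ := by
  classical
  have hx' : (x.swap, 0) ∈ refl σ := by simpa [mem_refl_zero]
  have hplus := sum_upNum hσ ℓ (beadsInCol_nonempty hσ hx ℓ)
  have hminus := sum_upNum (isPM_refl hσ) ℓ (beadsInCol_nonempty (isPM_refl hσ) hx' ℓ)
  rw [sum_beadsInCol_refl] at hminus
  simp only [Xcharge, ncard_Iplus hσ, ncard_Iminus hσ, Finset.sum_sub_distrib, ← Nat.cast_sum]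
  have hfree : ((Finset.univ.filter fun y : Pos L => y.1 + y.2 = ℓ ∧ UpFree (refl σ) y).card : ℝ) =
      ∑ y : Pos L, if y.1 + y.2 = ℓ ∧ (y, 1) ∈ σ ∧ (y - (0, 1), 2) ∈ σ then 1 else 0 := by
    rw [← Finset.sum_boole, ← Equiv.sum_comp (Equiv.prodComm (ZMod L) (ZMod L))]
    refine Finset.sum_congr rfl fun y _ => ?_
    rw [Equiv.prodComm_apply]
    simp only [upFree_refl, Prod.fst_swap, Prod.snd_swap, add_comm y.2]
  rw [hplus, hminus, hfree, ← Finset.sum_boole,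
    ← sum_shift 1 σ ℓ (1, 0) (by simp), edgeCount, ← Finset.sum_sub_distrib,
    ← Finset.sum_sub_distrib]
  refine Finset.sum_congr rfl fun y _ => ?_
  simp only [UpFree]
  obtain ⟨hw, hb⟩ := (isPM_iff σ).1 hσ y
  obtain ⟨h, h', h''⟩ | ⟨h, h', h''⟩ | ⟨h, h', h''⟩ := hw <;>
    obtain ⟨k, k', k''⟩ | ⟨k, k', k''⟩ | ⟨k, k', k''⟩ := hb <;> simp_all

open Classical in
theorem edgeCount_one_upMove [Nontrivial (ZMod L)] [NeZero L] {σ : Config L} (hσ : IsPM L σ)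
    {x : Pos L} (hx : CanUp L σ x) (ℓ : ZMod L) :
    edgeCount 1 (upMove L σ x) ℓ = edgeCount 1 σ ℓ + (if x.1 + x.2 = ℓ then 1 else 0) -
      (if x.1 + x.2 = ℓ + 1 then 1 else 0) := by
  have hd : x - (0, 1) ≠ x := by simp [Prod.ext_iff]
  have hc : (x - (0, 1)).1 + (x - (0, 1)).2 = ℓ ↔ x.1 + x.2 = ℓ + 1 := by
    simp only [Prod.fst_sub, Prod.snd_sub]
    constructor <;> intro h
    · linear_combination h
    · linear_combination h
  have h₁ : (if x.1 + x.2 = ℓ then (1 : ℝ) else 0) =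
      ∑ y : Pos L, if y = x then (if y.1 + y.2 = ℓ then 1 else 0) else 0 := by simp
  have h₂ : (if x.1 + x.2 = ℓ + 1 then (1 : ℝ) else 0) =
      ∑ y : Pos L, if y = x - (0, 1) then (if y.1 + y.2 = ℓ then 1 else 0) else 0 := by
    rw [Finset.sum_ite_eq', if_pos (Finset.mem_univ _)]
    simp only [hc]
  rw [h₁, h₂, edgeCount, edgeCount, ← Finset.sum_add_distrib, ← Finset.sum_sub_distrib]
  refine Finset.sum_congr rfl fun y _ => ?_
  have hw := ((isPM_iff σ).1 hσ x).1
  rw [canUp_iff] at hx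
  simp only [mem_upMove_one]
  unfold ExactlyOne at hw
  by_cases hy : y.1 + y.2 = ℓ
  · simp only [hy, true_and, if_true]
    by_cases hyx : y = x
    · subst hyx
      have : (y, 1) ∉ σ := by tauto
      simp [this, hd.symm]
    · by_cases hyx' : y = x - (0, 1)
      · subst hyx'
        simp [hx.2.2, hd]
      · simp [hyx, hyx']
  · simp [hy]

open Classical in
/-- The variation of the charge of column `ℓ` when the bead at `x` moves up by one step. -/
noncomputable def chargeStep (ℓ : ZMod L) (x : Pos L) : ℝ :=
  (if x.1 + x.2 = ℓ - 1 then 1 else 0) + (if x.1 + x.2 = ℓ + 1 then 1 else 0) -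
    2 * (if x.1 + x.2 = ℓ then 1 else 0)

theorem Xcharge_upMove [Nontrivial (ZMod L)] [NeZero L] {σ : Config L} (hσ : IsPM L σ)
    {x : Pos L} (hx : CanUp L σ x) (ℓ : ZMod L) :
    Xcharge L (upMove L σ x) ℓ = Xcharge L σ ℓ + chargeStep ℓ x := by
  have hb : (x + u L, 0) ∈ upMove L σ x := by simp [mem_upMove_zero]
  rw [Xcharge_eq (isPM_upMove hσ hx) hb, Xcharge_eq hσ ((canUp_iff _ _).1 hx).1,
    edgeCount_one_upMove hσ hx, edgeCount_one_upMove hσ hx, chargeStep, sub_add_cancel]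
  ring

theorem Xcharge_upIter [Nontrivial (ZMod L)] [NeZero L] (k : ℕ) {σ : Config L}
    (hσ : IsPM L σ) {x : Pos L} (hx : UpReach k σ x) (ℓ : ZMod L) :
    Xcharge L (upIter k σ x) ℓ = Xcharge L σ ℓ + k * chargeStep ℓ x := by
  induction k generalizing σ x with
  | zero => simp [upIter]
  | succ k ih =>
    have hstep : chargeStep ℓ (x + u L) = chargeStep ℓ x := by
      have := col_add_nsmul_u x 1
      rw [one_nsmul] at this
      rw [chargeStep, chargeStep, this]
    rw [upIter, ih (isPM_upMove hσ hx.1) hx.2, Xcharge_upMove hσ hx.1, hstep]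
    push_cast
    ring

open Classical in
theorem numUpJumps_eq [Nontrivial (ZMod L)] [NeZero L] {σ : Config L} (hσ : IsPM L σ)
    (τ : Config L) :
    (numUpJumps L σ τ : ℝ) =
      ∑ x : Pos L, ∑ k ∈ Finset.Icc 1 (upNum σ x), if τ = upIter k σ x then 1 else 0 := by
  rw [Finset.sum_sigma', Finset.sum_boole, numUpJumps]
  congr 1
  rw [← Set.ncard_coe_finset]
  symm
  refine Set.ncard_congr (fun (z : Σ _ : Pos L, ℕ) _ => (z.1, z.1 + z.2 • u L)) ?_ ?_ ?_
  · rintro ⟨x, k⟩ h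
    simp only [Finset.coe_filter, Finset.mem_sigma, Set.mem_ofPred_eq] at h
    rw [Set.mem_ofPred_eq, upPath_ne_iff hσ]
    exact ⟨k, h.1.2, rfl, h.2⟩
  · rintro ⟨x, k⟩ ⟨x', k'⟩ h h' he
    simp only [Finset.coe_filter, Finset.mem_sigma, Set.mem_ofPred_eq] at h h'
    obtain ⟨rfl, he⟩ := Prod.mk.inj he
    obtain rfl := injOn_add_nsmul_u hσ x (by simpa using h.1.2) (by simpa using h'.1.2) he
    rfl
  · rintro ⟨x, y⟩ h
    rw [Set.mem_ofPred_eq, upPath_ne_iff hσ] at h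
    obtain ⟨k, hk, hy, rfl⟩ := h
    obtain rfl : y = x + k • u L := hy
    exact ⟨⟨x, k⟩, by simpa using hk, rfl⟩

theorem sum_numUpJumps_mul [Nontrivial (ZMod L)] [NeZero L] {σ : Config L} (hσ : IsPM L σ)
    (ℓ : ZMod L) :
    ∑ τ : Config L, numUpJumps L σ τ * (Xcharge L τ ℓ - Xcharge L σ ℓ) =
      ∑ x : Pos L, chargeStep ℓ x * (upNum σ x * (upNum σ x + 1) / 2) := by
  classical
  simp only [numUpJumps_eq hσ, Finset.sum_mul]
  rw [Finset.sum_comm]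
  refine Finset.sum_congr rfl fun x _ => ?_
  rw [Finset.sum_comm]
  have hsum : ∀ n : ℕ, ∑ k ∈ Finset.Icc 1 n, (k : ℝ) = n * (n + 1) / 2 := by
    intro n
    induction n with
    | zero => simp
    | succ n ih =>
      rw [Finset.sum_Icc_succ_top (by omega), ih]
      push_cast
      ring
  rw [← hsum, Finset.mul_sum]
  refine Finset.sum_congr rfl fun k hk => ?_
  rw [Finset.mem_Icc, ← upReach_iff_le hσ] at hk
  simp only [ite_mul, one_mul, zero_mul, Finset.sum_ite_eq', Finset.mem_univ, if_true]
  rw [Xcharge_upIter k hσ hk.2]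
  ring

theorem Xcharge_refl [Nontrivial (ZMod L)] [NeZero L] {σ : Config L} (hσ : IsPM L σ)
    (ℓ : ZMod L) : Xcharge L (refl σ) ℓ = -Xcharge L σ ℓ := by
  rw [Xcharge, Xcharge, sum_beadsInCol_refl, ← Finset.sum_neg_distrib]
  refine Finset.sum_congr rfl fun x _ => ?_
  rw [ncard_Iplus hσ, ncard_Iminus hσ, ncard_Iplus (isPM_refl hσ), ncard_Iminus (isPM_refl hσ),
    refl_refl, Prod.swap_swap]
  ring

theorem isPM_of_numUpJumps_ne_zero [Nontrivial (ZMod L)] {σ τ : Config L}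
    (hσ : IsPM L σ) (h : numUpJumps L σ τ ≠ 0) : IsPM L τ := by
  obtain ⟨pr, -, hp⟩ := Set.nonempty_of_ncard_ne_zero h
  clear h
  generalize pr.1 = x, pr.2 = y at hp
  induction hp with
  | refl => exact hσ
  | step hc _ ih => exact ih (isPM_upMove hσ hc)

theorem sum_numDownJumps_mul [Nontrivial (ZMod L)] [NeZero L] {σ : Config L}
    (hσ : IsPM L σ) (ℓ : ZMod L) :
    ∑ τ : Config L, numDownJumps L σ τ * (Xcharge L τ ℓ - Xcharge L σ ℓ) =
      -∑ x : Pos L, chargeStep ℓ x *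
        (upNum (refl σ) x.swap * (upNum (refl σ) x.swap + 1) / 2) := by
  have h := sum_numUpJumps_mul (isPM_refl hσ) ℓ
  rw [← Equiv.sum_comp reflEquiv, ← Equiv.sum_comp (Equiv.prodComm (ZMod L) (ZMod L))] at h
  have hstep : ∀ x : Pos L, chargeStep ℓ x.swap = chargeStep ℓ x := fun x => by
    simp [chargeStep, add_comm]
  simp only [Equiv.prodComm_apply, hstep] at h
  rw [← h, ← Finset.sum_neg_distrib]
  refine Finset.sum_congr rfl fun τ _ => ?_
  change _ = -(numUpJumps L (refl σ) (refl τ) * (Xcharge L (refl τ) ℓ - _))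
  rw [numDownJumps_eq]
  by_cases h0 : numUpJumps L (refl σ) (refl τ) = 0
  · simp [h0]
  · have hτ := isPM_refl (isPM_of_numUpJumps_ne_zero (isPM_refl hσ) h0)
    rw [refl_refl] at hτ
    rw [Xcharge_refl hσ, Xcharge_refl hτ]
    ring

theorem sum_Gen_mul [NeZero L] (p q : ℝ) (σ : Config L) (f : Config L → ℝ) :
    ∑ τ : Config L, Gen L p q σ τ * f τ =
      p * ∑ τ : Config L, numUpJumps L σ τ * (f τ - f σ) +
        q * ∑ τ : Config L, numDownJumps L σ τ * (f τ - f σ) := by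
  have hoff : ∀ τ ∈ Finset.univ.erase σ, Gen L p q σ τ * f τ =
      (p * numUpJumps L σ τ + q * numDownJumps L σ τ) * f τ := fun τ hτ => by
    rw [Gen, if_neg (Finset.ne_of_mem_erase hτ)]
  rw [← Finset.add_sum_erase _ _ (Finset.mem_univ σ), Finset.sum_congr rfl hoff, Gen, if_pos rfl,
    neg_mul, Finset.sum_mul, ← Finset.sum_neg_distrib, ← Finset.sum_add_distrib,
    Finset.mul_sum, Finset.mul_sum, ← Finset.sum_add_distrib,
    ← Finset.add_sum_erase Finset.univ
      (fun τ => p * (numUpJumps L σ τ * (f τ - f σ)) + q * (numDownJumps L σ τ * (f τ - f σ)))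
      (Finset.mem_univ σ)]
  simp only [sub_self, mul_zero, zero_add]
  refine Finset.sum_congr rfl fun τ _ => ?_
  ring

open Classical in
theorem Ycur_eq [Nontrivial (ZMod L)] [NeZero L] (p : ℝ) {σ : Config L} (hσ : IsPM L σ)
    (ℓ : ZMod L) :
    Ycur L p σ ℓ = p * ∑ x : Pos L, (if x.1 + x.2 = ℓ then (1 : ℝ) else 0) *
      ((upNum (refl σ) x.swap : ℝ) * (upNum (refl σ) x.swap + 1) / 2 -
        (upNum σ x : ℝ) * (upNum σ x + 1) / 2) := by
  rw [Ycur, div_mul_eq_mul_div, mul_div_assoc, Finset.sum_div]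
  congr 1
  simp only [ncard_Iplus hσ, ncard_Iminus hσ]
  refine Finset.sum_subset_zero_on_sdiff (Finset.subset_univ _) (fun x hx => ?_) fun x hx => ?_
  · rw [Finset.mem_sdiff, mem_beadsInCol] at hx
    by_cases hc : x.1 + x.2 = ℓ
    · have hb : (x, 0) ∉ σ := fun h => hx.2 ⟨h, hc⟩
      have hb' : (x.swap, 0) ∉ refl σ := by simpa [mem_refl_zero]
      simp [upNum_eq_zero hσ hb, upNum_eq_zero (isPM_refl hσ) hb']
    · simp [hc]
  · rw [mem_beadsInCol] at hx
    rw [if_pos hx.2]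
    ring

variable (L)

/-- Let `L ≥ 3` and `p = q > 0`.  For every perfect matching `σ` of the
hexagonal torus `T_L` and every column index `ℓ ∈ ℤ/Lℤ`, the generator applied to the
charge `X_ℓ` satisfies the gradient condition
`∑_{σ'} 𝓛(σ,σ')·X_ℓ(σ') = 2·Y_ℓ(σ) − Y_{ℓ−1}(σ) − Y_{ℓ+1}(σ)`. -/
theorem gradient_condition [NeZero L] (hL : 3 ≤ L) (p q : ℝ) (hpq : p = q) (hp : 0 < p)
    (σ : Config L) (hσ : IsPM L σ) (ℓ : ZMod L) :
    ∑ σ' : Config L, Gen L p q σ σ' * Xcharge L σ' ℓ =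
      2 * Ycur L p σ ℓ - Ycur L p σ (ℓ - 1) - Ycur L p σ (ℓ + 1) := by
  have : Fact (1 < L) := ⟨by omega⟩
  subst hpq
  rw [sum_Gen_mul, sum_numUpJumps_mul hσ, sum_numDownJumps_mul hσ, Ycur_eq p hσ, Ycur_eq p hσ,
    Ycur_eq p hσ, ← mul_add, mul_left_comm, ← mul_sub, ← mul_sub]
  congr 1
  rw [Finset.mul_sum, ← Finset.sum_neg_distrib, ← Finset.sum_add_distrib,
    ← Finset.sum_sub_distrib, ← Finset.sum_sub_distrib]
  refine Finset.sum_congr rfl fun x _ => ?_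
  rw [chargeStep]
  ring

end HexDimer
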